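/- Let G be a finite simple graph on vertex set V with Laplacian matrix L, and let f : V → ℝ be a nonzero vector orthogonal to the all-ones vector (∑_v f(v) = 0). Then there exists a nonzero vector f̂ : V → ℝ with nonnegative entries such that (1) the number of vertices with f̂(v) > 0 is at most |V|/2, and (2) the Rayleigh quotient satisfies (f̂ᵀ L f̂)/(f̂ᵀ f̂) ≤ (fᵀ L f)/(fᵀ f). -/

import Mathlib

open scoped Matrix

/-- A real-valued function on a nonempty finite type has a median: a value strictly above and
strictly below which lie at most half of the points. -/
theorem exists_median {V : Type*} [Fintype V] [Nonempty V] (f : V → ℝ) :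
    ∃ m : ℝ, 2 * (Finset.univ.filter fun v => m < f v).card ≤ Fintype.card V ∧
      2 * (Finset.univ.filter fun v => f v < m).card ≤ Fintype.card V := by
  obtain ⟨a, ha⟩ := Finite.exists_max f
  obtain ⟨b, hb, hbmin⟩ := Finset.exists_min_image
    (Finset.univ.filter fun u => 2 * (Finset.univ.filter fun v => f u < f v).card ≤ Fintype.card V)
    f ⟨a, by simp [Finset.filter_false_of_mem, ha]⟩
  simp only [Finset.mem_filter, Finset.mem_univ, true_and] at hb hbmin
  refine ⟨f b, hb, ?_⟩
  by_contra! hlt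
  have hne : (Finset.univ.filter fun v => f v < f b).Nonempty := by
    rw [← Finset.card_pos]
    omega
  obtain ⟨w, hw, hwmax⟩ := Finset.exists_max_image _ f hne
  simp only [Finset.mem_filter, Finset.mem_univ, true_and] at hw hwmax
  refine (hbmin w ?_).not_gt hw
  have hsub : (Finset.univ.filter fun v => f w < f v) ⊆
      Finset.univ.filter fun v => ¬ f v < f b := by
    intro v hv
    simp only [Finset.mem_filter, Finset.mem_univ, true_and] at hv ⊢
    exact fun h => (hwmax v h).not_gt hv
  have hle := Finset.card_le_card hsub
  have hadd := Finset.card_filter_add_card_filter_not (s := Finset.univ) (fun v => f v < f b)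
  rw [Finset.card_univ] at hadd
  omega

theorem SimpleGraph.dotProduct_lapMatrix_mulVec {V : Type*} [Fintype V] [DecidableEq V]
    (G : SimpleGraph V) [DecidableRel G.Adj] (x : V → ℝ) :
    x ⬝ᵥ (G.lapMatrix ℝ *ᵥ x) =
      (∑ i : V, ∑ j : V, if G.Adj i j then (x i - x j) ^ 2 else 0) / 2 := by
  rw [← G.lapMatrix_toLinearMap₂' ℝ, Matrix.toLinearMap₂'_apply']

/-- Splitting a translate of `f` into its positive and negative parts does not increase the
Laplacian form. -/
theorem SimpleGraph.lapMatrix_posPart_add_negPart_le {V : Type*} [Fintype V] [DecidableEq V]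
    (G : SimpleGraph V) [DecidableRel G.Adj] (f : V → ℝ) (m : ℝ) :
    (fun v => max (f v - m) 0) ⬝ᵥ (G.lapMatrix ℝ *ᵥ fun v => max (f v - m) 0) +
      (fun v => max (m - f v) 0) ⬝ᵥ (G.lapMatrix ℝ *ᵥ fun v => max (m - f v) 0) ≤
        f ⬝ᵥ (G.lapMatrix ℝ *ᵥ f) := by
  simp only [G.dotProduct_lapMatrix_mulVec]
  rw [← add_div, ← Finset.sum_add_distrib]
  gcongr with i
  rw [← Finset.sum_add_distrib]
  gcongr with j
  split_ifs
  · rcases le_total (f i) m with hi | hi <;> rcases le_total (f j) m with hj | hj <;>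
      simp only [max_eq_left (sub_nonneg.2 hi), max_eq_right (sub_nonpos.2 hi),
        max_eq_left (sub_nonneg.2 hj), max_eq_right (sub_nonpos.2 hj)] <;>
      nlinarith [mul_nonneg (sub_nonneg.2 hi) (sub_nonneg.2 hj)]
  · simp

/-- Translating a function of zero sum and splitting it into positive and negative parts does not
decrease the total squared norm. -/
theorem dotProduct_self_le_posPart_add_negPart {V : Type*} [Fintype V]
    (f : V → ℝ) (hsum : ∑ v, f v = 0) (m : ℝ) :
    f ⬝ᵥ f ≤ (fun v => max (f v - m) 0) ⬝ᵥ (fun v => max (f v - m) 0) +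
      (fun v => max (m - f v) 0) ⬝ᵥ (fun v => max (m - f v) 0) := by
  have hlin : f ⬝ᵥ f = ∑ v, (f v * f v - 2 * m * f v) := by
    rw [Finset.sum_sub_distrib, ← Finset.mul_sum, hsum, mul_zero, sub_zero, dotProduct]
  rw [hlin, dotProduct, dotProduct, ← Finset.sum_add_distrib]
  gcongr with v
  rcases le_total (f v) m with hv | hv <;>
    simp only [max_eq_left (sub_nonneg.2 hv), max_eq_right (sub_nonpos.2 hv)] <;>
    nlinarith [sq_nonneg m]

/-- Given a nonzero vector `f` orthogonal to the all-ones vector, there is a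
nonzero nonnegative vector `f̂`, positive on at most half of the vertices,
whose Rayleigh quotient is no larger than that of `f`. -/
theorem exists_nonneg_half_support_rayleigh_le
    {V : Type*} [Fintype V] [DecidableEq V]
    (G : SimpleGraph V) [DecidableRel G.Adj]
    (f : V → ℝ) (hf : f ≠ 0) (hsum : (∑ v, f v) = 0) :
    ∃ g : V → ℝ, g ≠ 0 ∧ (∀ v, 0 ≤ g v) ∧
      (({v : V | 0 < g v}.ncard : ℝ) ≤ (Fintype.card V : ℝ) / 2) ∧
      (g ⬝ᵥ ((G.lapMatrix ℝ) *ᵥ g)) / (g ⬝ᵥ g) ≤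
        (f ⬝ᵥ ((G.lapMatrix ℝ) *ᵥ f)) / (f ⬝ᵥ f) := by
  obtain ⟨u, -⟩ := Function.ne_iff.1 hf
  have : Nonempty V := ⟨u⟩
  obtain ⟨m, hpos, hneg⟩ := exists_median f
  have hE := G.lapMatrix_posPart_add_negPart_le f m
  have hN := dotProduct_self_le_posPart_add_negPart f hsum m
  have hp_card : ({v : V | 0 < max (f v - m) 0}.ncard : ℝ) ≤ (Fintype.card V : ℝ) / 2 := by
    rw [le_div_iff₀' two_pos]
    simpa [Set.ncard_eq_toFinset_card'] using (by exact_mod_cast hpos :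
      2 * ((Finset.univ.filter fun v => m < f v).card : ℝ) ≤ Fintype.card V)
  have hq_card : ({v : V | 0 < max (m - f v) 0}.ncard : ℝ) ≤ (Fintype.card V : ℝ) / 2 := by
    rw [le_div_iff₀' two_pos]
    simpa [Set.ncard_eq_toFinset_card'] using (by exact_mod_cast hneg :
      2 * ((Finset.univ.filter fun v => f v < m).card : ℝ) ≤ Fintype.card V)
  have hp_nonneg : ∀ v, 0 ≤ max (f v - m) 0 := fun v => le_max_right _ _
  have hq_nonneg : ∀ v, 0 ≤ max (m - f v) 0 := fun v => le_max_right _ _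
  have dot_pos : ∀ g : V → ℝ, g ≠ 0 → 0 < g ⬝ᵥ g := fun g hg =>
    lt_of_le_of_ne (Finset.sum_nonneg fun v _ => mul_self_nonneg (g v))
      (Ne.symm (dotProduct_self_eq_zero.not.2 hg))
  have hF := dot_pos f hf
  by_contra! hno
  have hlt : ∀ g : V → ℝ, (∀ v, 0 ≤ g v) →
      ({v : V | 0 < g v}.ncard : ℝ) ≤ (Fintype.card V : ℝ) / 2 → g ≠ 0 →
      (f ⬝ᵥ (G.lapMatrix ℝ *ᵥ f)) * (g ⬝ᵥ g) < (g ⬝ᵥ (G.lapMatrix ℝ *ᵥ g)) * (f ⬝ᵥ f) :=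
    fun g hg hcard hg0 => (div_lt_div_iff₀ hF (dot_pos g hg0)).1 (hno g hg0 hg hcard)
  have hp := hlt _ hp_nonneg hp_card
  have hq := hlt _ hq_nonneg hq_card
  have hE0 : 0 ≤ f ⬝ᵥ (G.lapMatrix ℝ *ᵥ f) := by
    rw [G.dotProduct_lapMatrix_mulVec]
    positivity
  have hE' := mul_le_mul_of_nonneg_right hE hF.le
  have hN' := mul_le_mul_of_nonneg_left hN hE0
  clear hp_nonneg hp_card hq_nonneg hq_card
  generalize (fun v => max (f v - m) 0) = p at *
  generalize (fun v => max (m - f v) 0) = q at *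
  by_cases hp0 : p = 0 <;> by_cases hq0 : q = 0
  · simp only [hp0, hq0, zero_dotProduct, add_zero] at hN
    exact hN.not_gt hF
  · have := hq hq0
    simp only [hp0, zero_dotProduct, zero_add] at hE' hN'
    linarith
  · have := hp hp0
    simp only [hq0, zero_dotProduct, add_zero] at hE' hN'
    linarith
  · linarith [hp hp0, hq hq0]
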